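/- arXiv:1809.04304 — 4 statements merged into one kernel-verified Lean document; each statement's English description precedes it below -/
import Mathlib

section
/- Let n ≥ 2 and let T = (a_1, …, a_k) be a tuple of integers with 1 ≤ a_1 < a_2 < ⋯ < a_k < n. Then, as an identity of polynomials with integer coefficients, g_T(x) = p_{a_1}(x) · ( 1 + p_{n - a_1 - 1}(x + a_1 + 1) + ∑_{i=2}^{k} p_{a_i - a_1 - 1}(x + a_1 + 1) ). In particular p_{a_1}(x) divides g_T(x) in ℤ[x]. -/
open Polynomial Finset

/-- For a non-negative integer `a`, the polynomial `p_a(x) = ∏_{i=0}^{a} (x + i)` over `ℤ`. -/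
noncomputable def pP (a : ℕ) : Polynomial ℤ :=
  ∏ i ∈ Finset.range (a + 1), (X + C (i : ℤ))

theorem pP_split (m b : ℕ) (h : b < m) :
    pP m = pP b * (pP (m - b - 1)).comp (X + C ((b : ℤ) + 1)) := by
  obtain ⟨d, rfl⟩ : ∃ d, m = b + 1 + d := ⟨m - b - 1, by omega⟩
  have e : b + 1 + d - b - 1 = d := by omega
  rw [e]
  unfold pP
  rw [Polynomial.prod_comp, show b + 1 + d + 1 = (b + 1) + (d + 1) by ring,
    Finset.prod_range_add]
  congr 1
  refine Finset.prod_congr rfl fun i _ => ?_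
  simp only [add_comp, X_comp, C_comp]
  rw [add_assoc X, ← C_add]
  push_cast
  rfl

/-- Let `n ≥ 2` and `T = (a_1, …, a_k)` with `1 ≤ a_1 < a_2 < ⋯ < a_k < n`.  Then
`g_T(x) = p_{a_1}(x) * (1 + p_{n - a_1 - 1}(x + a_1 + 1) + ∑_{i=2}^{k} p_{a_i - a_1 - 1}(x + a_1 + 1))`
as polynomials with integer coefficients; in particular `p_{a_1}` divides `g_T` in `ℤ[X]`. -/
theorem statement1 (n k : ℕ) (a : ℕ → ℕ) (hn : 2 ≤ n) (hk : 1 ≤ k)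
    (ha1 : 1 ≤ a 0)
    (hmono : ∀ i j, i < j → j < k → a i < a j)
    (hlt : ∀ i, i < k → a i < n)
    (g : Polynomial ℤ) (hg : g = pP n + ∑ i ∈ Finset.range k, pP (a i)) :
    g = pP (a 0) *
        (1 + (pP (n - a 0 - 1)).comp (X + C ((a 0 : ℤ) + 1)) +
          ∑ i ∈ Finset.Ico 1 k, (pP (a i - a 0 - 1)).comp (X + C ((a 0 : ℤ) + 1)))
      ∧ pP (a 0) ∣ g := by
  have key : g = pP (a 0) *
        (1 + (pP (n - a 0 - 1)).comp (X + C ((a 0 : ℤ) + 1)) +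
          ∑ i ∈ Finset.Ico 1 k, (pP (a i - a 0 - 1)).comp (X + C ((a 0 : ℤ) + 1))) := by
    rw [hg, Finset.range_eq_Ico, Finset.sum_eq_sum_Ico_succ_bot (by omega : 0 < k),
      mul_add, mul_add, mul_one, Finset.mul_sum, ← pP_split n (a 0) (hlt 0 (by omega))]
    have hs : ∑ i ∈ Finset.Ico (0 + 1) k, pP (a i) = ∑ i ∈ Finset.Ico 1 k,
        pP (a 0) * (pP (a i - a 0 - 1)).comp (X + C ((a 0 : ℤ) + 1)) := by
      refine Finset.sum_congr rfl fun i hi => ?_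
      rw [Finset.mem_Ico] at hi
      exact pP_split (a i) (a 0) (hmono 0 i (by omega) hi.2)
    rw [hs]
    ring
  exact ⟨key, Dvd.intro _ key.symm⟩
end

section
/- Let n ≥ 2 and let T = (a_1, …, a_k) be a tuple of integers with 1 ≤ a_1 < a_2 < ⋯ < a_k < n. Then each of the integers x_0 = 0, −1, −2, …, −a_1 is a simple root of the polynomial g_T, i.e. g_T(x_0) = 0 and the root multiplicity of x_0 in g_T equals 1 (equivalently, the derivative g_T′(x_0) ≠ 0). -/
open Polynomial Finset

lemma pP_succ (a : ℕ) : pP (a + 1) = pP a * (X + C ((a + 1 : ℕ) : ℤ)) := by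
  unfold pP
  rw [Finset.prod_range_succ]

lemma pP_eval (a j : ℕ) (h : j ≤ a) : (pP a).eval (-(j : ℤ)) = 0 := by
  unfold pP
  rw [eval_prod]
  apply Finset.prod_eq_zero (i := j)
  · simp; omega
  · simp

lemma pP_deriv_pos (a j : ℕ) (h : j ≤ a) :
    0 < (-1) ^ j * (derivative (pP a)).eval (-(j : ℤ)) := by
  induction a, h using Nat.le_induction with
  | base =>
    have e : pP j = (∏ i ∈ Finset.range j, (X + C (i : ℤ))) * (X + C (j : ℤ)) := by
      unfold pP
      rw [Finset.prod_range_succ]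
    have e2 : ((-1 : ℤ)) ^ j = ∏ i ∈ Finset.range j, (-1 : ℤ) := by simp
    rw [e, derivative_mul, eval_add, eval_mul, eval_mul, eval_prod, e2]
    simp only [derivative_add, derivative_X, derivative_C, eval_add, eval_X, eval_C, eval_one,
      eval_zero, neg_add_cancel, mul_zero, zero_add, add_zero, mul_one]
    rw [← Finset.prod_mul_distrib]
    apply Finset.prod_pos
    intro i hi
    have := Finset.mem_range.mp hi
    push_cast
    omega
  | succ a h ih =>
    rw [pP_succ, derivative_mul, eval_add, eval_mul, eval_mul, pP_eval a j h, zero_mul, add_zero,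
      ← mul_assoc]
    apply mul_pos ih
    simp only [eval_add, eval_X, eval_C]
    push_cast
    omega

/-- Let `n ≥ 2` and `T = (a_1, …, a_k)` with `1 ≤ a_1 < a_2 < ⋯ < a_k < n`.  Then each of the
integers `x₀ = 0, -1, …, -a_1` is a simple root of `g_T`: `g_T(x₀) = 0` and `g_T'(x₀) ≠ 0`. -/
theorem statement2 (n k : ℕ) (a : ℕ → ℕ) (hn : 2 ≤ n) (hk : 1 ≤ k)
    (ha1 : 1 ≤ a 0)
    (hmono : ∀ i j, i < j → j < k → a i < a j)
    (hlt : ∀ i, i < k → a i < n)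
    (g : Polynomial ℤ) (hg : g = pP n + ∑ i ∈ Finset.range k, pP (a i)) :
    ∀ j : ℕ, j ≤ a 0 →
      g.eval (-(j : ℤ)) = 0 ∧ (Polynomial.derivative g).eval (-(j : ℤ)) ≠ 0 := by
  intro j hj
  have hja : ∀ i ∈ Finset.range k, j ≤ a i := by
    intro i hi
    have hi := Finset.mem_range.mp hi
    rcases Nat.eq_zero_or_pos i with h0 | h0
    · rw [h0]; exact hj
    · have := hmono 0 i h0 hi
      omega
  have hjn : j ≤ n := by
    have := hlt 0 (by omega)
    omega
  subst hg
  constructor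
  · rw [eval_add, eval_finsetSum, pP_eval n j hjn, zero_add]
    exact Finset.sum_eq_zero fun i hi => pP_eval _ _ (hja i hi)
  · intro h0
    have h1 := pP_deriv_pos n j hjn
    have h2 : 0 ≤ ∑ i ∈ Finset.range k, (-1) ^ j * (derivative (pP (a i))).eval (-(j : ℤ)) :=
      Finset.sum_nonneg fun i hi => (pP_deriv_pos _ _ (hja i hi)).le
    rw [derivative_add, derivative_sum, eval_add, eval_finsetSum] at h0
    rw [← Finset.mul_sum] at h2
    have h3 := congrArg (fun t => (-1 : ℤ) ^ j * t) h0
    simp only [mul_add, mul_zero] at h3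
    linarith
end

section
/- Let n ≥ 2 and let T = (a_1, …, a_k) be a tuple of integers with 1 ≤ a_1 < a_2 < ⋯ < a_k < n. Then there is no integer x with g_T(x) = 1 or g_T(x) = −1. -/
open Polynomial Finset

theorem pP_even (m : ℕ) (hm : 1 ≤ m) (x : ℤ) : (2 : ℤ) ∣ (pP m).eval x := by
  have h : (pP m).eval x = ∏ i ∈ Finset.range (m + 1), (x + (i : ℤ)) := by
    simp [pP, Polynomial.eval_prod]
  rw [h]
  have h2 : (∏ i ∈ Finset.range 2, (x + (i : ℤ))) ∣ ∏ i ∈ Finset.range (m + 1), (x + (i : ℤ)) :=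
    Finset.prod_dvd_prod_of_subset _ _ _ (Finset.range_subset_range.2 (by omega))
  refine dvd_trans ?_ h2
  have h3 := (Int.even_mul_succ_self x).two_dvd
  simpa [Finset.prod_range_succ] using h3

/-- Let `n ≥ 2` and `T = (a_1, …, a_k)` with `1 ≤ a_1 < a_2 < ⋯ < a_k < n`.  Then there is no
integer `x` with `g_T(x) = 1` or `g_T(x) = -1`. -/
theorem statement4 (n k : ℕ) (a : ℕ → ℕ) (hn : 2 ≤ n) (hk : 1 ≤ k)
    (ha1 : 1 ≤ a 0)
    (hmono : ∀ i j, i < j → j < k → a i < a j)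
    (hlt : ∀ i, i < k → a i < n)
    (g : Polynomial ℤ) (hg : g = pP n + ∑ i ∈ Finset.range k, pP (a i)) :
    ¬ ∃ x : ℤ, g.eval x = 1 ∨ g.eval x = -1 := by
  rintro ⟨x, hx⟩
  have hd : (2 : ℤ) ∣ g.eval x := by
    rw [hg, Polynomial.eval_add, Polynomial.eval_finsetSum]
    refine dvd_add (pP_even n (by omega) x) (Finset.dvd_sum fun i hi => pP_even _ ?_ x)
    rw [Finset.mem_range] at hi
    rcases Nat.eq_zero_or_pos i with h0 | h0
    · rw [h0]; exact ha1
    · have := hmono 0 i h0 hi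
      omega
  rcases hx with h | h <;> rw [h] at hd <;> omega
end

section
/- Let n ≥ 2 and let T = (a_1, …, a_k) be a tuple of integers with 0 ≤ a_1 < a_2 < ⋯ < a_k < n, and assume either a_1 ≥ 2, or k ≥ 3 with a_1 = 1, a_2 = 3 and a_3 ≥ 5. Then the set of exponents { m ∈ ℕ : m ≥ 2 and there exist integers x, y with y ≠ 0 and y^m = g_T(x) } is finite. -/
open Polynomial Finset

theorem zero_est (d L R S2 m : ℕ) (α β : ℝ) (hα : 0 < α) (hβ : 1 < β) (P : ℕ → ℝ[X])
    (hdeg : ∀ l < L, (P l).natDegree ≤ d) (hne : ∃ l < L, P l ≠ 0) (hS : S2 ≤ m)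
    (hRS : d * L < R * S2)
    (hz : ∀ r < R, ∀ s < S2 + L,
      ∑ l ∈ range L, (P l).eval ((r * m + s : ℕ) : ℝ) * (α ^ r * β ^ s) ^ l = 0) : False := by
  classical
  set I := (range L).filter (fun l => P l ≠ 0) with hI
  have hIL : I.card ≤ L := by simpa using card_filter_le (range L) (fun l => P l ≠ 0)
  set n := I.card with hn
  have hn0 : 0 < n := by
    obtain ⟨l, hl, h⟩ := hne
    exact card_pos.mpr ⟨l, by simp [hI, hl, h]⟩
  let f : Fin n → ℕ := I.orderEmbOfFin rfl
  have hfinj : Function.Injective f := (I.orderEmbOfFin rfl).injective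
  have hfI : ∀ j, f j ∈ I := fun j => I.orderEmbOfFin_mem rfl j
  have hfL : ∀ j, f j < L := fun j => by have := hfI j; simp [hI] at this; exact this.1
  have hfne : ∀ j, P (f j) ≠ 0 := fun j => by have := hfI j; simp [hI] at this; exact this.2
  let N : Matrix (Fin n) (Fin n) ℝ[X] := fun i j =>
    C (β ^ ((i : ℕ) * f j)) * (P (f j)).comp (X + C ((i : ℕ) : ℝ))
  let w : Fin n → ℝ[X] := fun j => X ^ (d - (P (f j)).natDegree)
  let M : Matrix (Fin n) (Fin n) ℝ[X] := Matrix.of fun i j => w j * N i j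
  have hdetM : M.det = (∏ j, w j) * N.det := Matrix.det_mul_row w N
  have hMdeg : ∀ i j, (M i j).natDegree ≤ d := by
    intro i j
    have h1 := hdeg _ (hfL j)
    simp only [M, N, w, Matrix.of_apply]
    refine (natDegree_mul_le).trans ?_
    have h2 := natDegree_C_mul_le (β ^ ((i : ℕ) * f j)) ((P (f j)).comp (X + C ((i : ℕ) : ℝ)))
    rw [natDegree_comp, natDegree_X_add_C, mul_one] at h2
    rw [natDegree_X_pow]
    omega
  have hMco : ∀ i j, (M i j).coeff d = (P (f j)).leadingCoeff * (β ^ (f j)) ^ (i : ℕ) := by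
    intro i j
    have h1 := hdeg _ (hfL j)
    simp only [M, N, w, Matrix.of_apply]
    have : d = (P (f j)).natDegree + (d - (P (f j)).natDegree) := by omega
    conv_lhs => rw [this]
    rw [show (P (f j)).natDegree + (d - (P (f j)).natDegree) - (P (f j)).natDegree
      = (d - (P (f j)).natDegree) by omega]
    rw [coeff_X_pow_mul, coeff_C_mul]
    have h3 : ((P (f j)).comp (X + C ((i : ℕ) : ℝ))).coeff (P (f j)).natDegree
        = (P (f j)).leadingCoeff := by
      have := leadingCoeff_comp (p := P (f j)) (q := (X + C ((i : ℕ) : ℝ))) (by rw [natDegree_X_add_C]; exact one_ne_zero)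
      rw [leadingCoeff, natDegree_comp, natDegree_X_add_C, mul_one, leadingCoeff_X_add_C, one_pow,
        mul_one] at this
      exact this
    rw [h3, ← pow_mul, mul_comm (f j)]
    ring
  have hcoef : M.det.coeff (n * d) ≠ 0 := by
    have h1 : M.det.coeff (n * d)
        = (Matrix.of fun i j => (P (f j)).leadingCoeff *
            (Matrix.vandermonde (fun j => β ^ (f j))).transpose i j).det := by
      rw [Matrix.det_apply, Matrix.det_apply, finsetSum_coeff]
      refine sum_congr rfl fun σ _ => ?_
      have h2 := coeff_prod_of_natDegree_le univ (fun i => M (σ i) i) d (fun i _ => hMdeg _ _)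
      rw [card_univ, Fintype.card_fin] at h2
      rw [coeff_smul, h2]
      congr 1
      refine prod_congr rfl fun i _ => ?_
      rw [hMco]
      simp [Matrix.vandermonde]
    rw [h1, Matrix.det_mul_row, Matrix.det_transpose]
    refine mul_ne_zero (prod_ne_zero_iff.mpr fun j _ => leadingCoeff_ne_zero.mpr (hfne j)) ?_
    rw [Matrix.det_vandermonde_ne_zero_iff]
    intro i j hij
    exact hfinj (pow_right_injective₀ (by linarith) hβ.ne' hij)
  have hdegdet : M.det.natDegree ≤ n * d := by
    rw [Matrix.det_apply]
    refine natDegree_sum_le_of_forall_le _ _ fun σ _ => ?_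
    refine (natDegree_smul_le _ _).trans ((natDegree_prod_le _ _).trans ?_)
    refine (sum_le_sum fun i _ => hMdeg (σ i) i).trans ?_
    simp
  let s : Finset ℝ := (range R ×ˢ range S2).image (fun x => ((x.1 * m + x.2 : ℕ) : ℝ))
  have hscard : s.card = R * S2 := by
    rw [card_image_of_injOn, card_product, card_range, card_range]
    rintro ⟨r, t⟩ h1 ⟨r', t'⟩ h2 h
    simp at h1 h2
    have h : r * m + t = r' * m + t' := by
      dsimp only at h
      exact_mod_cast h
    have hm : 0 < m := by omega
    have h3 : r = r' := by
      have e1 : (r * m + t) / m = r := by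
        rw [mul_comm, Nat.mul_add_div hm, Nat.div_eq_of_lt (by omega)]; rfl
      have e2 : (r' * m + t') / m = r' := by
        rw [mul_comm, Nat.mul_add_div hm, Nat.div_eq_of_lt (by omega)]; rfl
      rw [← e1, h, e2]
    subst h3
    simp at h ⊢; exact h
  have hzero : M.det = 0 := by
    apply eq_zero_of_natDegree_lt_card_of_eval_eq_zero' _ s
    · intro x hx
      simp only [s, mem_image, mem_product, mem_range, Prod.exists] at hx
      obtain ⟨r, t, ⟨hr, ht⟩, rfl⟩ := hx
      rw [hdetM, eval_mul]
      suffices h : eval (((r * m + t : ℕ) : ℝ)) N.det = 0 by rw [h, mul_zero]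
      have h1 : eval (((r * m + t : ℕ) : ℝ)) N.det
        = ((evalRingHom (((r * m + t : ℕ) : ℝ))).mapMatrix N).det := by
        rw [← RingHom.map_det]; rfl
      rw [h1, ← Matrix.exists_mulVec_eq_zero_iff]
      refine ⟨fun j => (α ^ r * β ^ t) ^ f j, ?_, ?_⟩
      · intro h
        have := congrFun h ⟨0, hn0⟩
        simp only [Pi.zero_apply] at this
        have h5 : 0 < (α ^ r * β ^ t) ^ f ⟨0, hn0⟩ := by positivity
        exact h5.ne' this
      · ext i
        have hN : ∀ j, ((evalRingHom (((r * m + t : ℕ) : ℝ))).mapMatrix N) i j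
            = β ^ ((i : ℕ) * f j) * (P (f j)).eval (((r * m + t : ℕ) : ℝ) + ((i : ℕ) : ℝ)) := by
          intro j
          rw [RingHom.mapMatrix_apply, Matrix.map_apply, coe_evalRingHom]
          change eval _ (C (β ^ ((i : ℕ) * f j)) * (P (f j)).comp (X + C ((i : ℕ) : ℝ))) = _
          rw [eval_mul, eval_C, eval_comp, eval_add, eval_X, eval_C]
        simp only [Matrix.mulVec, dotProduct, hN, Pi.zero_apply]
        have h6 := hz r hr (t + i) (by have := i.2; omega)
        have h7 : ∑ l ∈ range L, (P l).eval ((r * m + (t + i) : ℕ) : ℝ) * (α ^ r * β ^ (t+(i:ℕ))) ^ l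
          = ∑ l ∈ I, (P l).eval ((r * m + (t + i) : ℕ) : ℝ) * (α ^ r * β ^ (t+(i:ℕ))) ^ l := by
          symm
          refine sum_subset (filter_subset _ _) ?_
          intro l hl hl'
          have : P l = 0 := by
            by_contra h
            exact hl' (by simp [hI, h, mem_range.mp hl])
          simp [this]
        have h8 : I = univ.image f := by
          symm
          refine eq_of_subset_of_card_le (fun x hx => ?_) ?_
          · simp at hx; obtain ⟨j, rfl⟩ := hx; exact hfI j
          · rw [card_image_of_injective _ hfinj]; simp [hn]
        rw [h7, h8, sum_image (fun _ _ _ _ h => hfinj h)] at h6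
        rw [← h6]
        refine sum_congr rfl fun j _ => ?_
        rw [show ((r * m + (t + i) : ℕ) : ℝ) = ((r * m + t : ℕ) : ℝ) + (i : ℕ) by push_cast; ring]
        rw [pow_add, pow_mul]
        ring
    · rw [hscard]
      calc _ ≤ n * d := hdegdet
        _ ≤ d * L := by rw [mul_comm]; gcongr
        _ < _ := hRS
  exact hcoef (by rw [hzero]; simp)

theorem pigeon {ι : Type*} [Fintype ι] [DecidableEq ι] (T H Q : ℕ) (A : ι → ℕ → ℝ) (Mx δ : ℝ) (hδ : 0 < δ)
    (h0 : ∀ i n, 0 ≤ A i n) (hM : ∀ i n, A i n ≤ Mx)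
    (hQ : Fintype.card ι * H * Mx / δ < Q) (hc : Q ^ T < (H + 1) ^ Fintype.card ι) :
    ∃ c : ι → ℤ, c ≠ 0 ∧ (∀ i, |c i| ≤ H) ∧ ∀ n < T, |∑ i, (c i : ℝ) * A i n| ≤ δ := by
  let F : (ι → Fin (H + 1)) → ℕ → ℝ := fun v n => ∑ i, ((v i : ℕ) : ℝ) * A i n
  have hF0 : ∀ v n, 0 ≤ F v n := fun v n => sum_nonneg fun i _ => mul_nonneg (by positivity) (h0 _ _)
  have hF1 : ∀ v n, F v n ≤ Fintype.card ι * H * Mx := by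
    intro v n
    calc F v n ≤ ∑ i : ι, (H : ℝ) * Mx := by
          refine sum_le_sum fun i _ => ?_
          have : ((v i : ℕ) : ℝ) ≤ H := by exact_mod_cast Nat.lt_succ_iff.mp (v i).2
          exact mul_le_mul this (hM _ _) (h0 _ _) (by positivity)
      _ = _ := by simp [mul_assoc]
  have hlt : ∀ v n, ⌊F v n / δ⌋₊ < Q := by
    intro v n
    rw [Nat.floor_lt (div_nonneg (hF0 _ _) hδ.le)]
    exact lt_of_le_of_lt (by gcongr; exact hF1 v n) hQ
  let G : (ι → Fin (H + 1)) → (Fin T → Fin Q) := fun v n => ⟨⌊F v n / δ⌋₊, hlt v n⟩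
  obtain ⟨v, v', hne, hG⟩ := Fintype.exists_ne_map_eq_of_card_lt G (by simpa using hc)
  refine ⟨fun i => ((v i : ℕ) : ℤ) - ((v' i : ℕ) : ℤ), ?_, ?_, ?_⟩
  · intro h
    apply hne
    ext i
    have := congrFun h i
    simp at this
    omega
  · intro i
    have h1 := (v i).2
    have h2 := (v' i).2
    dsimp only
    rw [abs_le]
    constructor <;> omega
  · intro n hn
    have h1 : ⌊F v n / δ⌋₊ = ⌊F v' n / δ⌋₊ := by
      have := congrFun hG ⟨n, hn⟩
      simpa [G] using this
    have h2 : ∑ i, ((((v i : ℕ) : ℤ) - ((v' i : ℕ) : ℤ) : ℤ) : ℝ) * A i n = F v n - F v' n := by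
      simp only [F, ← sum_sub_distrib]
      refine sum_congr rfl fun i _ => ?_
      push_cast; ring
    rw [h2]
    have a1 := Nat.floor_le (div_nonneg (hF0 v n) hδ.le)
    have a2 := Nat.floor_le (div_nonneg (hF0 v' n) hδ.le)
    have a3 := Nat.lt_floor_add_one (F v n / δ)
    have a4 := Nat.lt_floor_add_one (F v' n / δ)
    rw [h1] at a1 a3
    have h3 : |F v n / δ - F v' n / δ| ≤ 1 := by rw [abs_le]; constructor <;> linarith
    rw [← sub_div, abs_div, abs_of_pos hδ, div_le_one hδ] at h3
    exact h3


theorem pigeon2 (K L T H Q : ℕ) (A : ℕ → ℕ → ℕ → ℝ) (Mx δ : ℝ) (hδ : 0 < δ)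
    (h0 : ∀ k l n, 0 ≤ A k l n) (hM : ∀ k < K, ∀ l < L, ∀ n, A k l n ≤ Mx)
    (hQ : (K * L : ℕ) * H * Mx / δ < Q) (hc : Q ^ T < (H + 1) ^ (K * L)) :
    ∃ c : ℕ → ℕ → ℤ, (∃ k < K, ∃ l < L, c k l ≠ 0) ∧ (∀ k l, |c k l| ≤ H) ∧
      ∀ n < T, |∑ k ∈ range K, ∑ l ∈ range L, (c k l : ℝ) * A k l n| ≤ δ := by
  obtain ⟨c, hc0, hcH, hcn⟩ := pigeon (ι := Fin K × Fin L) T H Q (fun i n => A i.1 i.2 n) Mx δ hδ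
    (fun i n => h0 _ _ _) (fun i n => hM _ i.1.2 _ i.2.2 _) (by simpa using hQ) (by simpa using hc)
  refine ⟨fun k l => if h : k < K ∧ l < L then c (⟨k, h.1⟩, ⟨l, h.2⟩) else 0, ?_, ?_, ?_⟩
  · obtain ⟨⟨k, l⟩, hkl⟩ := Function.ne_iff.mp hc0
    exact ⟨k, k.2, l, l.2, by simpa using hkl⟩
  · intro k l
    dsimp only
    split_ifs with h
    · exact hcH _
    · simp
  · intro n hn
    convert hcn n hn using 2
    rw [Fintype.sum_prod_type, ← Fin.sum_univ_eq_sum_range (fun k => ∑ l ∈ range L, _) K]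
    refine sum_congr rfl fun k _ => ?_
    rw [← Fin.sum_univ_eq_sum_range (fun l => _) L]
    refine sum_congr rfl fun l _ => ?_
    simp

/-- the polynomial `binom (X + k) k` -/
noncomputable def chP (k : ℕ) : ℝ[X] := ∏ i ∈ range k, (C (1 / ((i : ℝ) + 1)) * (X + C ((i : ℝ) + 1)))

/-- truncated exponential -/
noncomputable def exP (J : ℕ) (t : ℝ) : ℝ[X] := ∑ j ∈ range J, C (t ^ j / (j.factorial : ℝ)) * X ^ j

theorem chP_succ (k : ℕ) : chP (k + 1) = chP k * (C (1 / ((k : ℝ) + 1)) * (X + C ((k : ℝ) + 1))) := by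
  rw [chP, prod_range_succ]; rfl

theorem chP_eval (k z : ℕ) : (chP k).eval (z : ℝ) = ((z + k).choose k : ℝ) := by
  induction k with
  | zero => simp [chP]
  | succ k ih =>
    rw [chP_succ, eval_mul, ih, eval_mul, eval_C, eval_add, eval_X, eval_C]
    have := Nat.add_one_mul_choose_eq (z + k) k
    have h : ((z + k : ℝ) + 1) * ((z + k).choose k : ℝ) = ((z + (k + 1)).choose (k + 1) : ℝ) * (k + 1) := by
      exact_mod_cast this
    field_simp
    linarith

theorem chP_ne (k : ℕ) : chP k ≠ 0 := by
  rw [chP, prod_ne_zero_iff]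
  intro i _
  refine mul_ne_zero ?_ (X_add_C_ne_zero _)
  rw [Ne, C_eq_zero]
  positivity

theorem chP_deg (k : ℕ) : (chP k).natDegree = k := by
  induction k with
  | zero => simp [chP]
  | succ k ih =>
    have h : (1 / ((k : ℝ) + 1)) ≠ 0 := by positivity
    rw [chP_succ, natDegree_mul (chP_ne k) (mul_ne_zero (by rwa [Ne, C_eq_zero]) (X_add_C_ne_zero _)),
      ih, natDegree_C_mul h, natDegree_X_add_C]

theorem coeff_mul_nonneg' {p q : ℝ[X]} (hp : ∀ n, 0 ≤ p.coeff n) (hq : ∀ n, 0 ≤ q.coeff n) (n : ℕ) :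
    0 ≤ (p * q).coeff n := by
  rw [coeff_mul]
  exact sum_nonneg fun x _ => mul_nonneg (hp _) (hq _)

theorem chP_nonneg (k n : ℕ) : 0 ≤ (chP k).coeff n := by
  induction k generalizing n with
  | zero => simp [chP, coeff_one]; split_ifs <;> norm_num
  | succ k ih =>
    rw [chP_succ]
    refine coeff_mul_nonneg' ih (fun n => ?_) n
    rw [coeff_C_mul, coeff_add, coeff_X, coeff_C]
    split_ifs <;> positivity

theorem exP_nonneg (J : ℕ) (t : ℝ) (ht : 0 ≤ t) (n : ℕ) : 0 ≤ (exP J t).coeff n := by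
  rw [exP, finsetSum_coeff]
  refine sum_nonneg fun j _ => ?_
  rw [coeff_C_mul, coeff_X_pow]
  split_ifs <;> positivity

theorem exP_deg (J : ℕ) (t : ℝ) : (exP J t).natDegree ≤ J := by
  refine natDegree_sum_le_of_forall_le _ _ fun j hj => ?_
  refine (natDegree_C_mul_X_pow_le _ _).trans ?_
  exact (mem_range.mp hj).le

theorem exP_eval (J : ℕ) (t z : ℝ) : (exP J t).eval z = ∑ j ∈ range J, (t * z) ^ j / (j.factorial : ℝ) := by
  rw [exP, eval_finsetSum]
  refine sum_congr rfl fun j _ => ?_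
  rw [eval_mul, eval_C, eval_pow, eval_X, mul_pow]; ring

theorem exP_le (J : ℕ) (t z : ℝ) (h : 0 ≤ t * z) : (exP J t).eval z ≤ Real.exp (t * z) := by
  rw [exP_eval]; exact Real.sum_le_exp_of_nonneg h J

theorem exP_tail (J : ℕ) (t z : ℝ) (h : 0 ≤ t * z) (hJ : 2 * (t * z) ≤ J) :
    |Real.exp (t * z) - (exP J t).eval z| ≤ 2 * Real.exp (2 * (t * z)) / 2 ^ J := by
  rw [exP_eval]
  set x := t * z with hx
  have h1 := Complex.exp_bound' (x := (x : ℂ)) (n := J) (by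
    rw [Complex.norm_real, Real.norm_of_nonneg h, div_le_iff₀ (by positivity)]
    push_cast; linarith)
  have h2 : Complex.exp x - ∑ m ∈ range J, (x : ℂ) ^ m / (m.factorial : ℂ)
      = ((Real.exp x - ∑ j ∈ range J, x ^ j / (j.factorial : ℝ) : ℝ) : ℂ) := by push_cast; rfl
  rw [h2, Complex.norm_real, Complex.norm_real, Real.norm_eq_abs, Real.norm_of_nonneg h] at h1
  refine h1.trans ?_
  have h3 := Real.pow_div_factorial_le_exp (2 * x) (by linarith) J
  rw [mul_pow] at h3
  rw [le_div_iff₀ (by positivity)]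
  calc x ^ J / (J.factorial : ℝ) * 2 * 2 ^ J = 2 * (2 ^ J * x ^ J / (J.factorial : ℝ)) := by ring
    _ ≤ _ := by linarith

theorem chP_indep (K : ℕ) (c : ℕ → ℝ) (h : ∑ k ∈ range K, C (c k) * chP k = 0) : ∀ k < K, c k = 0 := by
  induction K with
  | zero => intro k hk; omega
  | succ K ih =>
    have h1 : c K = 0 := by
      have h2 := congrArg (fun p => coeff p K) h
      simp only [finsetSum_coeff, coeff_C_mul, coeff_zero] at h2
      rw [sum_range_succ, sum_eq_zero, zero_add] at h2
      · rcases mul_eq_zero.mp h2 with h3 | h3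
        · exact h3
        · exfalso
          have := chP_deg K
          have h4 := leadingCoeff_ne_zero.mpr (chP_ne K)
          rw [leadingCoeff, this] at h4
          exact h4 h3
      · intro k hk
        rw [coeff_eq_zero_of_natDegree_lt, mul_zero]
        rw [chP_deg]; exact mem_range.mp hk
    intro k hk
    rw [sum_range_succ, h1] at h
    rcases Nat.lt_succ_iff_lt_or_eq.mp hk with h5 | h5
    · exact ih (by simpa using h) k h5
    · rw [h5, h1]

theorem dbl_bound (K L : ℕ) (H W : ℝ) (c : ℕ → ℕ → ℤ) (X : ℕ → ℕ → ℝ) (hc : ∀ k l, |(c k l : ℝ)| ≤ H)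
    (hX : ∀ k < K, ∀ l < L, |X k l| ≤ W) :
    |∑ k ∈ range K, ∑ l ∈ range L, (c k l : ℝ) * X k l| ≤ K * L * (H * W) := by
  have hH : 0 ≤ H := (abs_nonneg _).trans (hc 0 0)
  calc _ ≤ ∑ k ∈ range K, ∑ l ∈ range L, |(c k l : ℝ) * X k l| :=
        (abs_sum_le_sum_abs _ _).trans (sum_le_sum fun k _ => abs_sum_le_sum_abs _ _)
    _ ≤ ∑ k ∈ range K, ∑ l ∈ range L, H * W := by
        refine sum_le_sum fun k hk => sum_le_sum fun l hl => ?_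
        rw [abs_mul]
        exact mul_le_mul (hc _ _) (hX _ (mem_range.mp hk) _ (mem_range.mp hl)) (abs_nonneg _) hH
    _ = _ := by simp; ring

theorem choose_bound (D g R m k z : ℕ) (hm : D ≤ m) (hg : 2 * m ≤ 2 ^ g) (hk : k < D * R)
    (hz : z ≤ R * m) : ((z + k).choose k : ℝ) ≤ 2 ^ (R * (D * g + 2)) := by
  have h1 : ((z + k).choose k : ℝ) ≤ ((z + k : ℕ) : ℝ) ^ k / (k.factorial : ℝ) := Nat.choose_le_pow_div _ _
  have h2 : ((z + k : ℕ) : ℝ) ≤ (2 ^ g) * R := by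
    have : D * R ≤ R * m := by rw [mul_comm]; gcongr
    have : z + k ≤ (2 * m) * R := by nlinarith
    calc ((z + k : ℕ) : ℝ) ≤ ((2 * m * R : ℕ) : ℝ) := by exact_mod_cast this
      _ ≤ ((2 ^ g * R : ℕ) : ℝ) := by exact_mod_cast Nat.mul_le_mul_right _ hg
      _ = _ := by push_cast; ring
  have h3 := Real.pow_div_factorial_le_exp (R : ℝ) (by positivity) k
  have h4 : Real.exp R ≤ 4 ^ R := by
    rw [← Real.exp_one_pow]
    gcongr
    have := Real.exp_one_lt_d9
    linarith
  calc _ ≤ ((2 ^ g) * R : ℝ) ^ k / (k.factorial : ℝ) := h1.trans (by gcongr)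
    _ = ((2:ℝ) ^ g) ^ k * ((R : ℝ) ^ k / (k.factorial : ℝ)) := by rw [mul_pow]; ring
    _ ≤ ((2:ℝ) ^ g) ^ (D * R) * 4 ^ R := by
        gcongr
        · exact one_le_pow₀ (by norm_num)
        · exact h3.trans h4
    _ = _ := by
        rw [show (4:ℝ) = 2 ^ 2 by norm_num, ← pow_mul, ← pow_mul, ← pow_add]
        congr 1; ring


theorem sq_le_two_pow (Y : ℕ) (h : 4 ≤ Y) : Y * Y ≤ 2 ^ Y := by
  induction Y, h using Nat.le_induction with
  | base => norm_num
  | succ n hn ih => rw [pow_succ]; nlinarith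

theorem siegel (h g m D1 D L R Y : ℕ) (lam : ℝ) (hlam : 0 ≤ lam) (hml : m * lam ≤ h * Real.log 2)
    (hD1 : D1 = 5 * h + 11) (hD : D = 4 * D1) (hL : L = D * g + 2) (hY : Y = R * L)
    (hR : 1 ≤ R) (hg1 : 1 ≤ g) (hDm : D ≤ m) (hg : 2 * m ≤ 2 ^ g) :
    ∃ c : ℕ → ℕ → ℤ, (∃ k < D * R, ∃ l < L, c k l ≠ 0) ∧ (∀ k l, |(c k l : ℝ)| ≤ ((2:ℝ) ^ Y) ^ (2 * h + 6)) ∧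
      ∀ z : ℕ, z ≤ R * m → |∑ k ∈ range (D * R), ∑ l ∈ range L, (c k l : ℝ) *
        (((z + k).choose k : ℝ) * Real.exp (l * lam * z))| ≤ 2 / ((2:ℝ) ^ Y) ^ (h + 2) := by
  have hDL : D + 2 ≤ L := by rw [hL]; nlinarith
  have hLY : L ≤ Y := by rw [hY]; nlinarith
  have hY4 : 4 ≤ Y := by omega
  have hDY : D * Y ≤ 2 ^ Y := (Nat.mul_le_mul_right _ (by omega)).trans (sq_le_two_pow Y hY4)
  set u : ℝ := (2:ℝ) ^ Y with hu
  have hu4 : (4:ℝ) ≤ u := by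
    calc (4:ℝ) = 2 ^ 2 := by norm_num
      _ ≤ 2 ^ Y := pow_le_pow_right₀ (by norm_num) (by omega)
  have hu1 : (1:ℝ) ≤ u := by linarith
  have hDYu : (D * Y : ℝ) ≤ u := by rw [hu]; exact_mod_cast hDY
  have hN : D * R * L = D * Y := by rw [hY]; ring
  set J := D1 * Y with hJ
  set T := D * R + J with hT
  have hTN : 2 * T ≤ D * Y := by
    rw [hT, hJ, hY, hD]
    have : 4 ≤ L := by omega
    have : D1 * R * 4 ≤ D1 * R * L := Nat.mul_le_mul_left _ this
    nlinarith
  set Z : ℕ := R * m with hZ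
  have hZpos : (0:ℝ) < Z := by
    have : 1 ≤ m := by omega
    have : 0 < R * m := by positivity
    exact_mod_cast this
  -- exponents
  have hexp : ∀ l < L, ∀ z ≤ Z, (0:ℝ) ≤ l * lam * z ∧ l * lam * z ≤ Y * (h * Real.log 2) := by
    intro l hl z hz
    refine ⟨by positivity, ?_⟩
    have hz' : (z : ℝ) ≤ R * m := by exact_mod_cast hz
    have hl' : (l : ℝ) ≤ L := by exact_mod_cast hl.le
    calc (l:ℝ) * lam * z ≤ L * lam * (R * m) := by gcongr
      _ = (R * L) * (m * lam) := by ring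
      _ ≤ (R * L) * (h * Real.log 2) := by gcongr
      _ = _ := by rw [hY]; push_cast; ring
  have hexpu : ∀ n : ℕ, ∀ x : ℝ, x ≤ Y * (h * Real.log 2) → Real.exp (n * x) ≤ u ^ (n * h) := by
    intro n x hx
    have : u ^ (n * h) = Real.exp (n * (Y * (h * Real.log 2))) := by
      rw [hu, ← pow_mul, ← Real.exp_log (show (0:ℝ) < 2 ^ (Y * (n * h)) by positivity), Real.log_pow]
      congr 1; push_cast; ring
    rw [this]
    gcongr
  have hch : ∀ k < D * R, ∀ z ≤ Z, ((z + k).choose k : ℝ) ≤ u := by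
    intro k hk z hz
    have := choose_bound D g R m k z hDm hg hk hz
    rwa [← hL, ← hY] at this
  let A : ℕ → ℕ → ℕ → ℝ := fun k l n => (chP k * exP J (l * lam)).coeff n * (Z:ℝ) ^ n
  have hcoef : ∀ k l n : ℕ, 0 ≤ (chP k * exP J (l * lam)).coeff n := fun k l n =>
    coeff_mul_nonneg' (chP_nonneg k) (exP_nonneg J _ (by positivity)) n
  have hA0 : ∀ k l n, 0 ≤ A k l n := fun k l n => mul_nonneg (hcoef k l n) (by positivity)
  have hAM : ∀ k < D * R, ∀ l < L, ∀ n, A k l n ≤ u ^ (h + 1) := by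
    intro k hk l hl n
    have h1 : A k l n ≤ (chP k * exP J (l * lam)).eval (Z:ℝ) := by
      rw [eval_eq_sum, sum_def]
      by_cases hn : n ∈ (chP k * exP J (l * lam)).support
      · exact single_le_sum (f := fun n => (chP k * exP J (l * lam)).coeff n * (Z:ℝ) ^ n)
          (fun i _ => hA0 k l i) hn
      · have : A k l n = 0 := by simp only [A, notMem_support_iff.mp hn, zero_mul]
        rw [this]
        exact sum_nonneg fun i _ => hA0 k l i
    refine h1.trans ?_
    rw [eval_mul, chP_eval]
    obtain ⟨e1, e2⟩ := hexp l hl Z le_rfl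
    have h2 := exP_le J (l * lam) Z e1
    have h3 := hexpu 1 _ e2
    simp only [Nat.cast_one, one_mul] at h3
    rw [pow_succ, mul_comm]
    exact mul_le_mul (h2.trans h3) (hch k hk Z le_rfl) (by positivity) (by positivity)
  obtain ⟨c, hc0, hcH, hcn⟩ := pigeon2 (D * R) L T (2 ^ (Y * (2 * h + 6))) (2 ^ (Y * (4 * h + 12))) A (u ^ (h + 1))
    (1 / u ^ (h + 3)) (by positivity) hA0 hAM (by
      rw [hN]
      push_cast
      rw [pow_mul, ← hu, pow_mul, ← hu, div_div_eq_mul_div, div_one]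
      calc (D * Y : ℝ) * u ^ (2 * h + 6) * u ^ (h + 1) * u ^ (h + 3)
          ≤ u * u ^ (2 * h + 6) * u ^ (h + 1) * u ^ (h + 3) := by gcongr
        _ = u ^ (4 * h + 11) := by ring
        _ < u ^ (4 * h + 12) := pow_lt_pow_right₀ (by linarith) (by omega)) (by
      rw [hN]
      calc (2 ^ (Y * (4 * h + 12))) ^ T = (2 ^ (Y * (2 * h + 6))) ^ (2 * T) := by
            rw [← pow_mul, ← pow_mul]; congr 1; ring
        _ ≤ (2 ^ (Y * (2 * h + 6))) ^ (D * Y) := Nat.pow_le_pow_right (by positivity) hTN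
        _ < _ := Nat.pow_lt_pow_left (Nat.lt_succ_self _) (by
            have : 0 < D := by omega
            positivity))
  have hcH' : ∀ k l, |(c k l : ℝ)| ≤ u ^ (2 * h + 6) := by
    intro k l
    have h1 : ((|c k l| : ℤ) : ℝ) ≤ (((2 ^ (Y * (2 * h + 6)) : ℕ) : ℤ) : ℝ) := by exact_mod_cast hcH k l
    push_cast at h1
    rwa [pow_mul, ← hu] at h1
  refine ⟨c, hc0, hcH', ?_⟩
  intro z hz
  have hz' : (z : ℝ) ≤ Z := by exact_mod_cast hz
  -- main polynomial part
  have hG : |∑ k ∈ range (D * R), ∑ l ∈ range L, (c k l : ℝ) *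
      (chP k * exP J (l * lam)).eval (z:ℝ)| ≤ 1 / u ^ (h + 2) := by
    have h1 : ∑ k ∈ range (D * R), ∑ l ∈ range L, (c k l : ℝ) * (chP k * exP J (l * lam)).eval (z:ℝ)
        = ∑ n ∈ range T, (∑ k ∈ range (D * R), ∑ l ∈ range L, (c k l : ℝ) * A k l n) * ((z:ℝ) / Z) ^ n := by
      simp_rw [sum_mul]
      rw [sum_comm (s := range T) (t := range (D * R))]
      refine sum_congr rfl fun k hk => ?_
      rw [sum_comm (s := range T) (t := range L)]
      refine sum_congr rfl fun l hl => ?_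
      rw [eval_eq_sum_range' (n := T), mul_sum]
      · refine sum_congr rfl fun n _ => ?_
        simp only [A]
        rw [div_pow]
        field_simp
      · refine lt_of_le_of_lt natDegree_mul_le ?_
        have := exP_deg J (l * lam)
        rw [chP_deg]
        have := mem_range.mp hk
        omega
    rw [h1]
    calc _ ≤ ∑ n ∈ range T, |(∑ k ∈ range (D * R), ∑ l ∈ range L, (c k l : ℝ) * A k l n) * ((z:ℝ) / Z) ^ n| :=
          abs_sum_le_sum_abs _ _
      _ ≤ ∑ n ∈ range T, 1 / u ^ (h + 3) := by
          refine sum_le_sum fun n hn => ?_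
          rw [abs_mul]
          have h2 : |((z:ℝ) / Z) ^ n| ≤ 1 := by
            rw [abs_of_nonneg (by positivity)]
            exact pow_le_one₀ (by positivity) ((div_le_one hZpos).mpr hz')
          calc _ ≤ 1 / u ^ (h + 3) * 1 := mul_le_mul (hcn n (mem_range.mp hn)) h2 (abs_nonneg _) (by positivity)
            _ = _ := mul_one _
      _ = T * (1 / u ^ (h + 3)) := by simp
      _ ≤ u * (1 / u ^ (h + 3)) := by
          gcongr
          have : (T : ℝ) ≤ (D * Y : ℕ) := by exact_mod_cast (by omega)
          push_cast at this
          linarith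
      _ = 1 / u ^ (h + 2) := by field_simp; ring
  have hTail : |∑ k ∈ range (D * R), ∑ l ∈ range L, (c k l : ℝ) * (((z + k).choose k : ℝ) *
      (Real.exp (l * lam * z) - (exP J (l * lam)).eval (z:ℝ)))| ≤ 1 / u ^ (h + 2) := by
    have h1 := dbl_bound (D * R) L (u ^ (2 * h + 6)) (u * (2 * u ^ (2 * h) / u ^ D1)) c
      (fun k l => ((z + k).choose k : ℝ) * (Real.exp (l * lam * z) - (exP J (l * lam)).eval (z:ℝ))) hcH' (by
        intro k hk l hl
        obtain ⟨e1, e2⟩ := hexp l hl z hz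
        rw [abs_mul, abs_of_nonneg (by positivity)]
        refine mul_le_mul (hch k hk z hz) ?_ (abs_nonneg _) (by positivity)
        have h2 := exP_tail J (l * lam) z e1 (by
          have h3 : Real.log 2 ≤ 1 := by have := Real.log_two_lt_d9; linarith
          rw [hJ, hD1]
          push_cast
          have : (Y:ℝ) * (h * Real.log 2) ≤ Y * (h * 1) := by gcongr
          nlinarith)
        refine h2.trans ?_
        have h3 := hexpu 2 _ e2
        push_cast at h3
        have h4 : (2:ℝ) ^ J = u ^ D1 := by rw [hu, ← pow_mul, hJ, mul_comm]
        rw [h4]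
        gcongr)
    refine h1.trans ?_
    have h5 : ((D * R : ℕ) : ℝ) * L = D * Y := by exact_mod_cast hN
    rw [h5]
    have h6 : u ^ D1 = u ^ (4 * h + 9) * u ^ (h + 2) := by rw [hD1]; ring
    calc (D * Y : ℝ) * (u ^ (2 * h + 6) * (u * (2 * u ^ (2 * h) / u ^ D1)))
        ≤ u * (u ^ (2 * h + 6) * (u * (u * u ^ (2 * h) / u ^ D1))) := by
          gcongr
          linarith
      _ = u ^ (4 * h + 9) / u ^ D1 := by ring
      _ = 1 / u ^ (h + 2) := by rw [h6]; field_simp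
  have hsplit : ∑ k ∈ range (D * R), ∑ l ∈ range L, (c k l : ℝ) *
        (((z + k).choose k : ℝ) * Real.exp (l * lam * z))
      = ∑ k ∈ range (D * R), ∑ l ∈ range L, (c k l : ℝ) * (chP k * exP J (l * lam)).eval (z:ℝ)
      + ∑ k ∈ range (D * R), ∑ l ∈ range L, (c k l : ℝ) * (((z + k).choose k : ℝ) *
      (Real.exp (l * lam * z) - (exP J (l * lam)).eval (z:ℝ))) := by
    simp_rw [← sum_add_distrib]
    refine sum_congr rfl fun k _ => sum_congr rfl fun l _ => ?_
    rw [eval_mul, chP_eval]; ring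
  rw [hsplit]
  refine (abs_add_le _ _).trans ?_
  rw [show 2 / u ^ (h + 2) = 1 / u ^ (h + 2) + 1 / u ^ (h + 2) by ring]
  exact add_le_add hG hTail


theorem pow_diff (x y W : ℝ) (hx : 0 ≤ x) (hy : 0 ≤ y) (hxW : x ≤ W) (hyW : y ≤ W) (hW : 1 ≤ W) (n : ℕ) :
    |x ^ n - y ^ n| ≤ n * W ^ n * |x - y| := by
  induction n with
  | zero => simp
  | succ n ih =>
    have h1 : x ^ (n + 1) - y ^ (n + 1) = x * (x ^ n - y ^ n) + (x - y) * y ^ n := by ring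
    rw [h1]
    refine (abs_add_le _ _).trans ?_
    rw [abs_mul, abs_mul, abs_of_nonneg hx, abs_of_nonneg (pow_nonneg hy n)]
    have h2 : x * |x ^ n - y ^ n| ≤ W * (n * W ^ n * |x - y|) := by gcongr
    have h3 : |x - y| * y ^ n ≤ |x - y| * W ^ (n + 1) := by
      gcongr
      calc y ^ n ≤ W ^ n := by gcongr
        _ ≤ W ^ (n + 1) := pow_le_pow_right₀ hW (by omega)
    calc _ ≤ W * (n * W ^ n * |x - y|) + |x - y| * W ^ (n + 1) := add_le_add h2 h3
      _ = _ := by push_cast; ring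

set_option maxHeartbeats 1600000 in
theorem main_step (h g w m a b p q D1 D L R Y : ℕ)
    (hD1 : D1 = 5 * h + 11) (hD : D = 4 * D1) (hL : L = D * g + 2) (hRdef : R = (D + 1) * w * L)
    (hY : Y = R * L) (hg1 : 1 ≤ g) (hw : 1 ≤ w)
    (ha : 1 ≤ a) (ha' : a ≤ 2 ^ h) (hb : 1 ≤ b) (hb' : b ≤ 2 ^ h)
    (hq0 : 1 ≤ q) (hqp : q < p) (hq1 : 2 ^ w ≤ q ^ 2) (hq2 : q ≤ 2 ^ w)
    (hpm : p ^ m ≤ 2 ^ h * q ^ m) (hc : |(a : ℤ) * p ^ m - b * q ^ m| ≤ 2 ^ h)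
    (hg : 2 * m ≤ 2 ^ g) (hm : 2 * (5 * h + 12) * ((D + 1) * L ^ 2) ≤ m) : False := by
  have hDL : D + 2 ≤ L := by rw [hL]; nlinarith
  have hR : 1 ≤ R := by
    rw [hRdef]
    have : 0 < L := by omega
    have : 0 < (D + 1) * w * L := by positivity
    omega
  have hLY : L ≤ Y := by rw [hY]; nlinarith
  have hY4 : 4 ≤ Y := by omega
  have hDY : D * Y ≤ 2 ^ Y := (Nat.mul_le_mul_right _ (by omega)).trans (sq_le_two_pow Y hY4)
  have hYu : (Y:ℝ) ≤ 2 ^ Y := by exact_mod_cast (Nat.lt_two_pow_self).le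
  set u : ℝ := (2:ℝ) ^ Y with hu
  have hu4 : (4:ℝ) ≤ u := by
    calc (4:ℝ) = 2 ^ 2 := by norm_num
      _ ≤ 2 ^ Y := pow_le_pow_right₀ (by norm_num) (by omega)
  have hu1 : (1:ℝ) ≤ u := by linarith
  have hDYu : (D * Y : ℝ) ≤ u := by rw [hu]; exact_mod_cast hDY
  have hN : D * R * L = D * Y := by rw [hY]; ring
  have hSm : (D + 1) * L ≤ m := by
    refine le_trans ?_ hm
    have h1 : (D + 1) * L ≤ (D + 1) * L ^ 2 := Nat.mul_le_mul_left _ (Nat.le_self_pow two_ne_zero L)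
    exact h1.trans (Nat.le_mul_of_pos_left _ (by omega))
  have hDm : D ≤ m := by
    have h1 : (D + 1) * 1 ≤ (D + 1) * L := Nat.mul_le_mul_left _ (by omega)
    omega
  have hqR : (0:ℝ) < q := by exact_mod_cast hq0
  have haR : (0:ℝ) < a := by exact_mod_cast ha
  have hbR : (0:ℝ) < b := by exact_mod_cast hb
  set β : ℝ := p / q with hβ
  set α : ℝ := b / a with hα
  have hβ1 : 1 < β := by rw [hβ, one_lt_div hqR]; exact_mod_cast hqp
  have hα0 : 0 < α := by positivity
  have hβm : β ^ m ≤ 2 ^ h := by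
    rw [hβ, div_pow, div_le_iff₀ (by positivity)]; exact_mod_cast hpm
  have hα2 : α ≤ 2 ^ h := by
    rw [hα, div_le_iff₀ haR]
    have h1 : (b:ℝ) ≤ 2 ^ h := by exact_mod_cast hb'
    have h2 : (1:ℝ) ≤ a := by exact_mod_cast ha
    nlinarith
  have hdiff : |α - β ^ m| ≤ 2 ^ h / q ^ m := by
    have h1 : α - β ^ m = -((a:ℝ) * p ^ m - b * q ^ m) / (a * q ^ m) := by
      rw [hα, hβ, div_pow]; field_simp; ring
    have h2 : |(a:ℝ) * p ^ m - b * q ^ m| ≤ 2 ^ h := by exact_mod_cast hc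
    rw [h1, abs_div, abs_neg, abs_of_pos (show (0:ℝ) < a * q ^ m by positivity)]
    gcongr
    have : (1:ℝ) ≤ a := by exact_mod_cast ha
    nlinarith [show (0:ℝ) < q ^ m by positivity]
  set lam := Real.log β with hlam
  have hlam0 : 0 ≤ lam := Real.log_nonneg hβ1.le
  have hml : m * lam ≤ h * Real.log 2 := by
    rw [hlam, ← Real.log_pow, ← Real.log_pow]
    exact Real.log_le_log (by positivity) hβm
  obtain ⟨c, hc0, hcH, hcz⟩ := siegel h g m D1 D L R Y lam hlam0 hml hD1 hD hL hY hR hg1 hDm hg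
  have hqm : u ^ (5 * h + 12) ≤ q ^ m := by
    have h1 : (u ^ (5 * h + 12)) ^ 2 ≤ ((q:ℝ) ^ m) ^ 2 := by
      calc (u ^ (5 * h + 12)) ^ 2 = 2 ^ (w * (2 * (5 * h + 12) * ((D + 1) * L ^ 2))) := by
            rw [hu, ← pow_mul, ← pow_mul, hY, hRdef]; congr 1; ring
        _ ≤ 2 ^ (w * m) := pow_le_pow_right₀ (by norm_num) (Nat.mul_le_mul_left _ hm)
        _ = ((2:ℝ) ^ w) ^ m := by rw [pow_mul]
        _ ≤ ((q:ℝ) ^ 2) ^ m := by gcongr; exact_mod_cast hq1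
        _ = _ := by rw [← pow_mul, ← pow_mul, mul_comm]
    exact le_of_sq_le_sq h1 (by positivity)
  have h2u : ((2:ℝ) ^ h) ≤ u := pow_le_pow_right₀ (by norm_num) (by omega)
  have h2Y : ((2:ℝ) ^ h) ^ Y = u ^ h := by rw [hu, ← pow_mul, ← pow_mul, mul_comm]
  have h21 : (1:ℝ) ≤ 2 ^ h := one_le_pow₀ (by norm_num)
  -- vanishing
  have hvan : ∀ r < R, ∀ s < D * L + L, ∑ k ∈ range (D * R), ∑ l ∈ range L, (c k l : ℝ) *
      (((r * m + s + k).choose k : ℝ) * (α ^ r * β ^ s) ^ l) = 0 := by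
    intro r hr s hs
    have hsm : s < m := by have : (D + 1) * L = D * L + L := by ring
                           omega
    have hz : r * m + s ≤ R * m := by
      have h1 : (r + 1) * m ≤ R * m := Nat.mul_le_mul_right _ hr
      have h2 : (r + 1) * m = r * m + m := by ring
      omega
    have hrl : ∀ l < L, r * l ≤ Y := fun l hl => by rw [hY]; exact Nat.mul_le_mul hr.le hl.le
    have h1 := hcz (r * m + s) hz
    have h2 : |∑ k ∈ range (D * R), ∑ l ∈ range L, (c k l : ℝ) *
      (((r * m + s + k).choose k : ℝ) * ((α ^ (r * l) - (β ^ m) ^ (r * l)) * β ^ (s * l)))|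
        ≤ 1 / u ^ (h + 2) := by
      have h3 := dbl_bound (D * R) L (u ^ (2 * h + 6)) (u * ((u * u ^ h * (u / q ^ m)) * u ^ h)) c
        (fun k l => ((r * m + s + k).choose k : ℝ) * ((α ^ (r * l) - (β ^ m) ^ (r * l)) * β ^ (s * l))) hcH (by
        intro k hk l hl
        have e1 := choose_bound D g R m k (r * m + s) hDm hg hk hz
        rw [← hL, ← hY, ← hu] at e1
        have e2 := pow_diff α (β ^ m) (2 ^ h) hα0.le (by positivity) hα2 hβm h21 (r * l)
        have e3 : ((r * l : ℕ) : ℝ) ≤ u := le_trans (by exact_mod_cast hrl l hl) hYu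
        have e4 : ((2:ℝ) ^ h) ^ (r * l) ≤ u ^ h := by
          rw [← h2Y]; exact pow_le_pow_right₀ h21 (hrl l hl)
        have e5 : β ^ (s * l) ≤ u ^ h := by
          calc β ^ (s * l) ≤ β ^ (m * Y) :=
                pow_le_pow_right₀ hβ1.le (Nat.mul_le_mul hsm.le (by omega))
            _ = (β ^ m) ^ Y := by rw [pow_mul]
            _ ≤ (2 ^ h) ^ Y := by gcongr
            _ = _ := h2Y
        rw [abs_mul, abs_mul, abs_of_nonneg (by positivity), abs_of_nonneg (a := β ^ (s * l)) (by positivity)]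
        have e6 : |α ^ (r * l) - (β ^ m) ^ (r * l)| ≤ u * u ^ h * (u / q ^ m) := by
          refine e2.trans ?_
          have : |α - β ^ m| ≤ u / q ^ m := hdiff.trans (by gcongr)
          gcongr
        gcongr)
      refine h3.trans ?_
      have h5 : ((D * R : ℕ) : ℝ) * L = D * Y := by exact_mod_cast hN
      rw [h5]
      calc (D * Y : ℝ) * (u ^ (2 * h + 6) * (u * ((u * u ^ h * (u / q ^ m)) * u ^ h)))
          ≤ u * (u ^ (2 * h + 6) * (u * ((u * u ^ h * (u / u ^ (5 * h + 12))) * u ^ h))) := by gcongr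
        _ = u ^ (4 * h + 10) / u ^ (5 * h + 12) := by ring
        _ = 1 / u ^ (h + 2) := by
            rw [show u ^ (5 * h + 12) = u ^ (4 * h + 10) * u ^ (h + 2) by ring]; field_simp
    have hsplit : ∑ k ∈ range (D * R), ∑ l ∈ range L, (c k l : ℝ) *
        (((r * m + s + k).choose k : ℝ) * (α ^ r * β ^ s) ^ l)
      = ∑ k ∈ range (D * R), ∑ l ∈ range L, (c k l : ℝ) *
        (((r * m + s + k).choose k : ℝ) * Real.exp (l * lam * ((r * m + s : ℕ) : ℝ)))
      + ∑ k ∈ range (D * R), ∑ l ∈ range L, (c k l : ℝ) *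
      (((r * m + s + k).choose k : ℝ) * ((α ^ (r * l) - (β ^ m) ^ (r * l)) * β ^ (s * l))) := by
      simp_rw [← sum_add_distrib]
      refine sum_congr rfl fun k _ => sum_congr rfl fun l _ => ?_
      have e1 : Real.exp (l * lam * ((r * m + s : ℕ) : ℝ)) = (β ^ m) ^ (r * l) * β ^ (s * l) := by
        rw [← pow_mul, ← pow_add, ← Real.exp_log (show 0 < β ^ (m * (r * l) + s * l) by positivity),
          Real.log_pow, ← hlam]
        congr 1
        push_cast; ring
      rw [e1, mul_pow, ← pow_mul, ← pow_mul]
      ring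
    set V := ∑ k ∈ range (D * R), ∑ l ∈ range L, (c k l : ℝ) *
        (((r * m + s + k).choose k : ℝ) * (α ^ r * β ^ s) ^ l) with hV
    have hVs : |V| ≤ 3 / u ^ (h + 2) := by
      rw [hsplit]
      refine (abs_add_le _ _).trans ?_
      calc _ ≤ 2 / u ^ (h + 2) + 1 / u ^ (h + 2) := add_le_add h1 h2
        _ = _ := by ring
    set S := (D + 1) * L with hS
    have hvex : ∃ v : ℤ, (a:ℝ) ^ Y * (q:ℝ) ^ (S * L) * V = v := by
      refine ⟨∑ k ∈ range (D * R), ∑ l ∈ range L, c k l * (((r * m + s + k).choose k : ℤ) *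
        ((b:ℤ) ^ (r * l) * a ^ (Y - r * l) * (p ^ (s * l) * q ^ (S * L - s * l)))), ?_⟩
      rw [hV, mul_sum]
      push_cast
      refine sum_congr rfl fun k _ => ?_
      rw [mul_sum]
      refine sum_congr rfl fun l hl => ?_
      have hl' := mem_range.mp hl
      have e1 : (a:ℝ) ^ Y = a ^ (r * l) * a ^ (Y - r * l) := by
        rw [← pow_add]; congr 1; have := hrl l hl'; omega
      have e2 : (q:ℝ) ^ (S * L) = q ^ (s * l) * q ^ (S * L - s * l) := by
        rw [← pow_add]; congr 1
        have : s * l ≤ S * L := Nat.mul_le_mul (by rw [hS]; linarith) hl'.le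
        omega
      rw [e1, e2, mul_pow, ← pow_mul, ← pow_mul, hα, hβ, div_pow, div_pow]
      field_simp
    obtain ⟨v, hv⟩ := hvex
    have hsz : (a:ℝ) ^ Y * (q:ℝ) ^ (S * L) ≤ u ^ (h + 1) := by
      have e1 : (a:ℝ) ^ Y ≤ u ^ h := by
        rw [← h2Y]; gcongr; exact_mod_cast ha'
      have e2 : (q:ℝ) ^ (S * L) ≤ u := by
        calc (q:ℝ) ^ (S * L) ≤ (2 ^ w) ^ (S * L) := by gcongr; exact_mod_cast hq2
          _ = u := by rw [hu, ← pow_mul, hY, hRdef, hS]; congr 1; ring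
      rw [pow_succ]
      gcongr
    have hv1 : |(v:ℝ)| < 1 := by
      rw [← hv, abs_mul, abs_of_pos (show (0:ℝ) < (a:ℝ) ^ Y * (q:ℝ) ^ (S * L) by positivity)]
      calc _ ≤ u ^ (h + 1) * (3 / u ^ (h + 2)) := by gcongr
        _ = 3 / u := by rw [pow_succ u (h + 1)]; field_simp
        _ < 1 := by rw [div_lt_one (by linarith)]; linarith
    have hv0 : v = 0 := by
      have : |v| < 1 := by exact_mod_cast hv1
      exact Int.abs_lt_one_iff.mp this
    rw [hv0, Int.cast_zero] at hv
    rcases mul_eq_zero.mp hv with h9 | h9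
    · exact absurd h9 (by positivity)
    · exact h9
  -- zero estimate
  let P : ℕ → ℝ[X] := fun l => ∑ k ∈ range (D * R), C (c k l : ℝ) * chP k
  refine zero_est (D * R - 1) L R (D * L) m α β hα0 hβ1 P ?_ ?_
    ((Nat.mul_le_mul_right L (Nat.le_succ D)).trans hSm) ?_ ?_
  · intro l _
    refine natDegree_sum_le_of_forall_le _ _ fun k hk => ?_
    refine (natDegree_C_mul_le _ _).trans ?_
    rw [chP_deg]
    have := mem_range.mp hk
    omega
  · obtain ⟨k, hk, l, hl, hkl⟩ := hc0
    refine ⟨l, hl, fun h0 => hkl ?_⟩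
    have := chP_indep (D * R) (fun k => (c k l : ℝ)) h0 k hk
    exact_mod_cast this
  · have h0 : 0 < D * R := Nat.mul_pos (by omega) (by omega)
    calc (D * R - 1) * L < D * R * L := Nat.mul_lt_mul_of_pos_right (by omega) (by omega)
      _ = _ := by ring
  · intro r hr s hs
    rw [← hvan r hr s hs, sum_comm]
    refine sum_congr rfl fun l _ => ?_
    simp only [P, eval_finsetSum, sum_mul]
    refine sum_congr rfl fun k _ => ?_
    rw [eval_mul, eval_C, chP_eval]
    ring


theorem growth (c : ℕ) : ∃ G : ℕ, ∀ g ≥ G, c * g ^ 2 ≤ 2 ^ g := by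
  have h := tendsto_pow_const_div_const_pow_of_one_lt 2 (show (1:ℝ) < 2 by norm_num)
  have h2 := (h.eventually (gt_mem_nhds (show (0:ℝ) < 1 / (c + 1) by positivity)))
  obtain ⟨G, hG⟩ := Filter.eventually_atTop.mp h2
  refine ⟨G, fun g hg => ?_⟩
  have h3 := hG g hg
  rw [div_lt_div_iff₀ (by positivity) (by positivity)] at h3
  have h4 : (c:ℝ) * (g:ℝ) ^ 2 ≤ 2 ^ g := by nlinarith [sq_nonneg (g:ℝ)]
  exact_mod_cast h4

theorem lemA (B : ℕ) : ∃ M, ∀ m ≥ M, ∀ a b p q : ℕ, 1 ≤ a → a ≤ B → 1 ≤ b → b ≤ B → 1 ≤ q → q < p →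
    ¬ |(a : ℤ) * p ^ m - b * q ^ m| ≤ B := by
  obtain ⟨h, hh⟩ : ∃ h, h = B + 1 := ⟨_, rfl⟩
  obtain ⟨D1, hD1⟩ : ∃ D1, D1 = 5 * h + 11 := ⟨_, rfl⟩
  obtain ⟨D, hD⟩ : ∃ D, D = 4 * D1 := ⟨_, rfl⟩
  obtain ⟨G, hG⟩ := growth (4 * (2 * (5 * h + 12) * ((D + 1) * (D + 2) ^ 2)))
  refine ⟨2 ^ G + h + 1, ?_⟩
  intro m hm a b p q ha ha' hb hb' hq hqp hc
  have hGpos : 0 < 2 ^ G := by positivity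
  have h2B : 2 * B ≤ 2 ^ h := by
    rw [hh, pow_succ, mul_comm]; exact Nat.mul_le_mul_right _ (Nat.lt_two_pow_self).le
  have hpm : p ^ m ≤ 2 ^ h * q ^ m := by
    have h1 : (a:ℤ) * p ^ m ≤ b * q ^ m + B := by have := (abs_le.mp hc).2; linarith
    have h1 : a * p ^ m ≤ b * q ^ m + B := by exact_mod_cast h1
    have h3 : 1 ≤ q ^ m := Nat.one_le_pow _ _ hq
    have h4 : b * q ^ m ≤ B * q ^ m := Nat.mul_le_mul_right _ hb'
    have h5 : B * 1 ≤ B * q ^ m := Nat.mul_le_mul_left _ h3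
    have h6 : 1 * p ^ m ≤ a * p ^ m := Nat.mul_le_mul_right _ ha
    have h7 : 2 * B * q ^ m ≤ 2 ^ h * q ^ m := Nat.mul_le_mul_right _ h2B
    nlinarith
  have hq2 : 2 ≤ q := by
    by_contra hq2
    have : q = 1 := by omega
    subst this
    rw [one_pow, mul_one] at hpm
    have h1 : 2 ^ m ≤ p ^ m := Nat.pow_le_pow_left (by omega) _
    have h2 : 2 ^ h < 2 ^ m := Nat.pow_lt_pow_right (by norm_num) (by omega)
    omega
  have hm0 : m ≠ 0 := by omega
  have hglog : G ≤ Nat.log 2 m := by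
    apply Nat.le_log_of_pow_le (by norm_num); omega
  refine main_step h (Nat.log 2 m + 2) (Nat.log 2 q + 1) m a b p q D1 D _ _ _ hD1 hD rfl rfl rfl (by omega)
    (by omega) ha (by omega) hb (by omega) hq hqp ?_ (Nat.lt_pow_succ_log_self (by norm_num) q).le hpm ?_ ?_ ?_
  · have := Nat.pow_log_le_self 2 (show q ≠ 0 by omega)
    rw [pow_succ]; nlinarith
  · refine hc.trans ?_
    have : B ≤ 2 ^ h := by omega
    exact_mod_cast this
  · have := Nat.lt_pow_succ_log_self (show 1 < 2 by norm_num) m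
    rw [pow_succ] at this ⊢
    rw [pow_succ]
    omega
  · set g := Nat.log 2 m + 2 with hg
    have h1 := hG g (by omega)
    have h2 : 2 ^ g ≤ 4 * m := by
      have := Nat.pow_log_le_self 2 hm0
      rw [hg, pow_add]; omega
    have h3 : (D * g + 2) ^ 2 ≤ ((D + 2) * g) ^ 2 := by
      apply Nat.pow_le_pow_left
      have : D * g + 2 * g = (D + 2) * g := by ring
      omega
    have h4 : 2 * (5 * h + 12) * ((D + 1) * (D * g + 2) ^ 2)
        ≤ 2 * (5 * h + 12) * ((D + 1) * ((D + 2) * g) ^ 2) := by gcongr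
    have h5 : 4 * (2 * (5 * h + 12) * ((D + 1) * (D + 2) ^ 2)) * g ^ 2
      = 4 * (2 * (5 * h + 12) * ((D + 1) * ((D + 2) * g) ^ 2)) := by ring
    omega

theorem uniq_pow (l : ℕ) (hl : l.Prime) (s t A B : ℕ) (hA : ¬ l ∣ A) (hB : ¬ l ∣ B)
    (h : l ^ s * A = l ^ t * B) : s = t ∧ A = B := by
  have key : ∀ s t A B : ℕ, ¬ l ∣ A → l ^ s * A = l ^ t * B → t ≤ s := by
    intro s t A B hA h
    have h1 : l ^ t ∣ l ^ s := by
      refine Nat.Coprime.dvd_of_dvd_mul_right ?_ (Dvd.intro _ h.symm)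
      exact Nat.Coprime.pow_left _ ((Nat.Prime.coprime_iff_not_dvd hl).mpr hA)
    exact (Nat.pow_dvd_pow_iff_le_right hl.one_lt).mp h1
  have : s = t := le_antisymm (key t s B A hB h.symm) (key s t A B hA h)
  subst this
  exact ⟨rfl, Nat.eq_of_mul_eq_mul_left (pow_pos hl.pos _) h⟩

theorem powlem (m : ℕ) (hm : 0 < m) : ∀ d : ℕ, 0 < d → ∀ X W y : ℕ, y ≠ 0 → X * W = y ^ m → Nat.gcd X W ∣ d →
    ∃ A A' u : ℕ, 0 < A ∧ A ≤ d ∧ 0 < A' ∧ A' ≤ d ∧ A' * X = A * u ^ m := by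
  intro d
  induction d using Nat.strong_induction_on with
  | _ d ih =>
  intro hd X W y hy hXW hgcd
  have hXW0 : X * W ≠ 0 := by rw [hXW]; exact pow_ne_zero _ hy
  have hX0 : X ≠ 0 := left_ne_zero_of_mul hXW0
  have hW0 : W ≠ 0 := right_ne_zero_of_mul hXW0
  by_cases hd1 : d = 1
  · subst hd1
    have hco : Nat.Coprime X W := Nat.dvd_one.mp hgcd
    obtain ⟨u, hu⟩ := exists_eq_pow_of_mul_eq_pow (by rw [Nat.isUnit_iff]; exact hco) hXW
    exact ⟨1, 1, u, by simp [hu]⟩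
  · obtain ⟨l, hl, hld⟩ := Nat.exists_prime_and_dvd hd1
    obtain ⟨e, d', hd', rfl⟩ := Nat.exists_eq_pow_mul_and_not_dvd hd.ne' l hl.ne_one
    obtain ⟨i, X', hX', rfl⟩ := Nat.exists_eq_pow_mul_and_not_dvd hX0 l hl.ne_one
    obtain ⟨j, W', hW', rfl⟩ := Nat.exists_eq_pow_mul_and_not_dvd hW0 l hl.ne_one
    obtain ⟨v, y', hy', rfl⟩ := Nat.exists_eq_pow_mul_and_not_dvd hy l hl.ne_one
    have he : e ≠ 0 := by
      rintro rfl
      rw [pow_zero, one_mul] at hld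
      exact hd' hld
    obtain ⟨h1, h2⟩ := uniq_pow l hl (i + j) (v * m) (X' * W') (y' ^ m)
      (by rw [hl.dvd_mul]; tauto) (fun h => hy' (hl.dvd_of_dvd_pow h)) (by
        rw [pow_add, pow_mul, ← mul_pow, ← hXW]; ring)
    have hd'0 : 0 < d' := Nat.pos_of_ne_zero (by rintro rfl; simp at hd')
    have hlt : d' < l ^ e * d' := by
      have : 1 < l ^ e := Nat.one_lt_pow he hl.one_lt
      nlinarith
    have hg' : Nat.gcd X' W' ∣ d' := by
      have h3 : Nat.gcd X' W' ∣ l ^ e * d' :=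
        (Nat.gcd_dvd_gcd_of_dvd_left _ (Dvd.intro_left _ rfl)).trans
          ((Nat.gcd_dvd_gcd_of_dvd_right _ (Dvd.intro_left _ rfl)).trans hgcd)
      refine Nat.Coprime.dvd_of_dvd_mul_left ?_ h3
      refine Nat.Coprime.pow_right _ (Nat.Coprime.symm ((Nat.Prime.coprime_iff_not_dvd hl).mpr ?_))
      exact fun h => hX' (h.trans (Nat.gcd_dvd_left _ _))
    have hmin : min i j ≤ e := by
      have h3 : l ^ min i j ∣ l ^ e * d' := by
        refine (Nat.dvd_gcd ?_ ?_).trans hgcd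
        · exact (pow_dvd_pow _ (min_le_left _ _)).trans (Dvd.intro _ rfl)
        · exact (pow_dvd_pow _ (min_le_right _ _)).trans (Dvd.intro _ rfl)
      have h4 : l ^ min i j ∣ l ^ e := by
        refine Nat.Coprime.dvd_of_dvd_mul_right ?_ h3
        exact Nat.Coprime.pow_left _ ((Nat.Prime.coprime_iff_not_dvd hl).mpr hd')
      exact (Nat.pow_dvd_pow_iff_le_right hl.one_lt).mp h4
    obtain ⟨A, A', u, a1, a2, a3, a4, a5⟩ := ih d' hlt hd'0 X' W' y'
      (by rintro rfl; simp at hy') h2 hg'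
    have hle : d' ≤ l ^ e * d' := hlt.le
    rcases min_le_iff.mp hmin with hi | hj
    · refine ⟨l ^ i * A, A', u, Nat.mul_pos (pow_pos hl.pos _) a1, ?_, a3, a4.trans hle, ?_⟩
      · exact Nat.mul_le_mul (Nat.pow_le_pow_right hl.pos hi) a2
      · calc A' * (l ^ i * X') = l ^ i * (A' * X') := by ring
          _ = _ := by rw [a5]; ring
    · refine ⟨A, l ^ j * A', l ^ v * u, a1, a2.trans hle, Nat.mul_pos (pow_pos hl.pos _) a3, ?_, ?_⟩
      · exact Nat.mul_le_mul (Nat.pow_le_pow_right hl.pos hj) a4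
      · calc l ^ j * A' * (l ^ i * X') = l ^ (i + j) * (A' * X') := by rw [pow_add]; ring
          _ = _ := by rw [a5, h1, mul_pow, ← pow_mul]; ring

set_option maxHeartbeats 1600000 in
theorem fin_main (Q : ℤ[X]) (hQ0 : Q.eval 0 ≠ 0) (hQ1 : Q.eval (-1) ≠ 0) :
    Set.Finite {m : ℕ | 2 ≤ m ∧ ∃ x y : ℤ, y ≠ 0 ∧ y ^ m = x * (x + 1) * Q.eval x} := by
  obtain ⟨d0, hd0⟩ : ∃ d0, d0 = (Q.eval 0).natAbs := ⟨_, rfl⟩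
  obtain ⟨d1, hd1⟩ : ∃ d1, d1 = (Q.eval (-1)).natAbs := ⟨_, rfl⟩
  have hd0p : 0 < d0 := by rw [hd0]; exact Int.natAbs_pos.mpr hQ0
  have hd1p : 0 < d1 := by rw [hd1]; exact Int.natAbs_pos.mpr hQ1
  obtain ⟨M, hM⟩ := lemA (d0 * d1)
  let F : ℤ → ℕ := fun x => (x * (x + 1) * Q.eval x).natAbs
  refine (Set.finite_lt_nat (M + d0 * d1 + ∑ x ∈ Finset.Icc (-(d0:ℤ)) d0, F x + 1)).subset ?_
  rintro m ⟨hm2, x, y, hy, hxy⟩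
  rw [Set.mem_ofPred_eq]
  by_contra hcon
  have hmM : M ≤ m := by omega
  have hmd : d0 * d1 < m := by omega
  have hmF : ∑ x ∈ Finset.Icc (-(d0:ℤ)) d0, F x < m := by omega
  have hne : x * (x + 1) * Q.eval x ≠ 0 := by rw [← hxy]; exact pow_ne_zero _ hy
  have hx0 : x ≠ 0 := by rintro rfl; simp at hne
  have hx1 : x + 1 ≠ 0 := by intro h; simp [h] at hne
  have hm0 : 0 < m := by omega
  have e1 : x.natAbs * ((x + 1) * Q.eval x).natAbs = y.natAbs ^ m := by
    rw [← Int.natAbs_mul, ← Int.natAbs_pow, hxy]; congr 1; ring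
  have e2 : (x + 1).natAbs * (x * Q.eval x).natAbs = y.natAbs ^ m := by
    rw [← Int.natAbs_mul, ← Int.natAbs_pow, hxy]; congr 1; ring
  have g1 : Nat.gcd x.natAbs ((x + 1) * Q.eval x).natAbs ∣ d0 := by
    have h1 := sub_dvd_eval_sub x 0 ((X + 1) * Q)
    simp only [eval_mul, eval_add, eval_X, eval_one, sub_zero, zero_add, one_mul] at h1
    rw [hd0, ← Int.natCast_dvd]
    have h2 : ((Nat.gcd x.natAbs ((x + 1) * Q.eval x).natAbs : ℕ) : ℤ) ∣ x :=
      Int.natCast_dvd.mpr (Nat.gcd_dvd_left _ _)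
    have h3 : ((Nat.gcd x.natAbs ((x + 1) * Q.eval x).natAbs : ℕ) : ℤ) ∣ (x + 1) * Q.eval x :=
      Int.natCast_dvd.mpr (Nat.gcd_dvd_right _ _)
    have h4 := dvd_sub h3 (h2.trans h1)
    rwa [sub_sub_cancel] at h4
  have g2 : Nat.gcd (x + 1).natAbs (x * Q.eval x).natAbs ∣ d1 := by
    have h1 := sub_dvd_eval_sub x (-1) (X * Q)
    simp only [eval_mul, eval_X, sub_neg_eq_add] at h1
    rw [hd1, ← Int.natCast_dvd]
    have h2 : ((Nat.gcd (x + 1).natAbs (x * Q.eval x).natAbs : ℕ) : ℤ) ∣ x + 1 :=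
      Int.natCast_dvd.mpr (Nat.gcd_dvd_left _ _)
    have h3 : ((Nat.gcd (x + 1).natAbs (x * Q.eval x).natAbs : ℕ) : ℤ) ∣ x * Q.eval x :=
      Int.natCast_dvd.mpr (Nat.gcd_dvd_right _ _)
    have h4 := dvd_sub h3 (h2.trans h1)
    rw [sub_sub_cancel] at h4
    simpa using h4
  obtain ⟨A, A', u, a1, a2, a3, a4, a5⟩ := powlem m hm0 d0 hd0p _ _ _ (Int.natAbs_ne_zero.mpr hy) e1 g1
  obtain ⟨B, B', v, b1, b2, b3, b4, b5⟩ := powlem m hm0 d1 hd1p _ _ _ (Int.natAbs_ne_zero.mpr hy) e2 g2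
  have hu : 1 ≤ u := by
    rcases Nat.eq_zero_or_pos u with h | h
    · rw [h, zero_pow hm0.ne', mul_zero] at a5
      rcases mul_eq_zero.mp a5 with h' | h'
      · omega
      · exact absurd (Int.natAbs_eq_zero.mp h') hx0
    · exact h
  have hv : 1 ≤ v := by
    rcases Nat.eq_zero_or_pos v with h | h
    · rw [h, zero_pow hm0.ne', mul_zero] at b5
      rcases mul_eq_zero.mp b5 with h' | h'
      · omega
      · exact absurd (Int.natAbs_eq_zero.mp h') hx1
    · exact h
  have ha5 : (A' : ℤ) * |x| = A * u ^ m := by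
    rw [Int.abs_eq_natAbs]; exact_mod_cast a5
  have hb5 : (B' : ℤ) * |x + 1| = B * v ^ m := by
    rw [Int.abs_eq_natAbs]; exact_mod_cast b5
  have hdiff : |(|x + 1| - |x|)| = 1 := by
    rcases lt_or_ge x 0 with h | h
    · rw [abs_of_neg h, abs_of_nonpos (show x + 1 ≤ 0 by omega)]; ring_nf; simp
    · rw [abs_of_nonneg h, abs_of_nonneg (show 0 ≤ x + 1 by omega)]; ring_nf; simp
  have hkey : ((A' * B : ℕ) : ℤ) * v ^ m - ((B' * A : ℕ) : ℤ) * u ^ m = (A' * B' : ℕ) * (|x + 1| - |x|) := by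
    push_cast
    calc (A':ℤ) * B * v ^ m - B' * A * u ^ m = A' * (B * v ^ m) - B' * (A * u ^ m) := by ring
      _ = _ := by rw [← ha5, ← hb5]; ring
  have hkabs : |((A' * B : ℕ) : ℤ) * v ^ m - ((B' * A : ℕ) : ℤ) * u ^ m| = (A' * B' : ℕ) := by
    rw [hkey, abs_mul, hdiff, mul_one]; exact abs_of_nonneg (by positivity)
  have hAB : A' * B' ≤ d0 * d1 := Nat.mul_le_mul a4 b4
  have hABz : ((A' * B' : ℕ) : ℤ) ≤ ((d0 * d1 : ℕ) : ℤ) := by exact_mod_cast hAB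
  have c1 : 1 ≤ A' * B := Nat.mul_pos a3 b1
  have c2 : A' * B ≤ d0 * d1 := Nat.mul_le_mul a4 b2
  have c3 : 1 ≤ B' * A := Nat.mul_pos b3 a1
  have c4 : B' * A ≤ d0 * d1 := by rw [mul_comm]; exact Nat.mul_le_mul a2 b4
  rcases lt_trichotomy u v with h | h | h
  · exact hM m hmM _ _ v u c1 c2 c3 c4 hu h (by rw [hkabs]; exact hABz)
  · subst h
    rcases Nat.lt_or_ge u 2 with hu2 | hu2
    · have : u = 1 := by omega
      subst this
      rw [one_pow, mul_one] at a5
      have hxd : x.natAbs ≤ d0 := (Nat.le_mul_of_pos_left _ a3).trans (a5.le.trans a2)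
      have hmem : x ∈ Finset.Icc (-(d0:ℤ)) d0 := by rw [mem_Icc]; omega
      have h1 : F x ≤ ∑ x ∈ Finset.Icc (-(d0:ℤ)) d0, F x :=
        single_le_sum (f := F) (fun _ _ => Nat.zero_le _) hmem
      have h2 : F x = y.natAbs ^ m := by simp only [F]; rw [← hxy, Int.natAbs_pow]
      have h3 : 2 ≤ y.natAbs := by
        have hev : Even (y ^ m) := by rw [hxy]; exact (Int.even_mul_succ_self x).mul_right _
        have hev : Even y := (Int.even_pow.mp hev).1
        obtain ⟨t, ht⟩ := hev
        omega
      have h4 : m < 2 ^ m := Nat.lt_two_pow_self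
      have h5 : 2 ^ m ≤ y.natAbs ^ m := Nat.pow_le_pow_left h3 m
      omega
    · have h1 : |((A' * B : ℕ) : ℤ) - ((B' * A : ℕ) : ℤ)| * (u:ℤ) ^ m = (A' * B' : ℕ) := by
        rw [← hkabs, ← sub_mul, abs_mul, abs_of_nonneg (a := (u:ℤ) ^ m) (by positivity)]
      have h2 : 1 ≤ |((A' * B : ℕ) : ℤ) - ((B' * A : ℕ) : ℤ)| := by
        rcases eq_or_ne (((A' * B : ℕ) : ℤ) - ((B' * A : ℕ) : ℤ)) 0 with h | h
        · exfalso
          rw [h, abs_zero, zero_mul] at h1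
          have : 0 < A' * B' := Nat.mul_pos a3 b3
          have : A' * B' = 0 := by exact_mod_cast h1.symm
          omega
        · exact Int.one_le_abs h
      have h3 : (u:ℤ) ^ m ≤ (A' * B' : ℕ) := by
        rw [← h1]; exact le_mul_of_one_le_left (by positivity) h2
      have h3 : u ^ m ≤ A' * B' := by exact_mod_cast h3
      have h4 : m < 2 ^ m := Nat.lt_two_pow_self
      have h5 : 2 ^ m ≤ u ^ m := Nat.pow_le_pow_left hu2 m
      omega
  · exact hM m hmM _ _ u v c3 c4 c1 c2 hv h (by rw [abs_sub_comm, hkabs]; exact hABz)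


/-- the cofactor of `X (X + 1)` in `pP a` -/
noncomputable def rP (a : ℕ) : Polynomial ℤ := ∏ i ∈ Finset.range (a - 1), (X + C ((i : ℤ) + 2))

theorem pP_eval_s5 (a : ℕ) (ha : 1 ≤ a) (x : ℤ) : (pP a).eval x = x * (x + 1) * (rP a).eval x := by
  obtain ⟨b, rfl⟩ : ∃ b, a = b + 1 := ⟨a - 1, by omega⟩
  rw [pP, rP, prod_range_succ', prod_range_succ', eval_mul, eval_mul, Nat.add_sub_cancel]
  have : ∀ k ∈ range b, (X + C (((k + 1 + 1 : ℕ)) : ℤ) : ℤ[X]) = X + C ((k:ℤ) + 2) := by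
    intro k _
    congr 2
  rw [prod_congr rfl this]
  simp only [eval_add, eval_X, eval_C]
  push_cast; ring

theorem rP_pos (a : ℕ) (x : ℤ) (hx : -1 ≤ x) : 0 < (rP a).eval x := by
  rw [rP, eval_prod]
  refine prod_pos fun i _ => ?_
  simp only [eval_add, eval_X, eval_C]
  omega

/-- Let `n ≥ 2` and `T = (a_1, …, a_k)` with `0 ≤ a_1 < a_2 < ⋯ < a_k < n`, and assume either
`a_1 ≥ 2`, or `k ≥ 3` with `a_1 = 1`, `a_2 = 3`, `a_3 ≥ 5`.  Then the set of exponents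
`{m : ℕ | m ≥ 2 and y^m = g_T(x) for some integers x, y with y ≠ 0}` is finite. -/
theorem statement5 (n k : ℕ) (a : ℕ → ℕ) (hn : 2 ≤ n) (hk : 1 ≤ k)
    (hmono : ∀ i j, i < j → j < k → a i < a j)
    (hlt : ∀ i, i < k → a i < n)
    (hcase : 2 ≤ a 0 ∨ (3 ≤ k ∧ a 0 = 1 ∧ a 1 = 3 ∧ 5 ≤ a 2))
    (g : Polynomial ℤ) (hg : g = pP n + ∑ i ∈ Finset.range k, pP (a i)) :
    Set.Finite {m : ℕ | 2 ≤ m ∧ ∃ x y : ℤ, y ≠ 0 ∧ y ^ m = g.eval x} := by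
  have ha1 : ∀ i < k, 1 ≤ a i := by
    intro i hi
    have h0 : 1 ≤ a 0 := by omega
    rcases Nat.eq_zero_or_pos i with h | h
    · rw [h]; exact h0
    · have := hmono 0 i h hi; omega
  let Q : ℤ[X] := rP n + ∑ i ∈ Finset.range k, rP (a i)
  have hQ : ∀ x : ℤ, -1 ≤ x → 0 < Q.eval x := by
    intro x hx
    simp only [Q, eval_add, eval_finsetSum]
    exact add_pos_of_pos_of_nonneg (rP_pos n x hx) (sum_nonneg fun i _ => (rP_pos _ x hx).le)
  have hgQ : ∀ x : ℤ, g.eval x = x * (x + 1) * Q.eval x := by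
    intro x
    rw [hg]
    simp only [Q, eval_add, eval_finsetSum]
    rw [pP_eval_s5 n (by omega), mul_add (x * (x + 1)), mul_sum]
    congr 1
    refine sum_congr rfl fun i hi => ?_
    exact pP_eval_s5 _ (ha1 i (mem_range.mp hi)) x
  have h := fin_main Q (hQ 0 (by norm_num)).ne' (hQ (-1) le_rfl).ne'
  simp only [hgQ]
  exact h
end
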